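/- arXiv:2307.07652 — 5 statements merged into one kernel-verified Lean document; each statement's English description precedes it below -/
import Mathlib

section
/- Let (r_t)_{t≥0} be a sequence of nonnegative real numbers with r_0 > 0, let d > 0, b > 0, c > 0 be real parameters and T a natural number, and set η := min{ 1/d, √(r_0/(b·(T+1))), (r_0/(c·(T+1)))^{1/3} }. Then r_0/((T+1)·η) + b·η + c·η² ≤ 2·√(b·r_0/(T+1)) + 2·(r_0·√c/(T+1))^{2/3} + d·r_0/(T+1). -/
/-- If `a = b * x ^ 2 = c * y ^ 3`, then `η = min (1 / d) (min x y)` balances the three terms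
`a / η`, `b * η`, `c * η ^ 2`. -/
theorem div_min_add_le {a b c d x y : ℝ} (ha : 0 < a) (hb : 0 < b) (hc : 0 < c) (hd : 0 < d)
    (hx : 0 < x) (hy : 0 < y) (hbx : b * x ^ 2 = a) (hcy : c * y ^ 3 = a) :
    a / min (1 / d) (min x y) + b * min (1 / d) (min x y) + c * min (1 / d) (min x y) ^ 2
      ≤ 2 * (b * x) + 2 * (c * y ^ 2) + d * a := by
  set η := min (1 / d) (min x y) with hη
  have hη0 : 0 < η := lt_min (by positivity) (lt_min hx hy)
  have hηx : η ≤ x := (min_le_right _ _).trans (min_le_left _ _)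
  have hηy : η ≤ y := (min_le_right _ _).trans (min_le_right _ _)
  have hb_le : b * η ≤ b * x := by gcongr
  have hc_le : c * η ^ 2 ≤ c * y ^ 2 := by gcongr
  have hbx0 : 0 < b * x := by positivity
  have hcy0 : 0 < c * y ^ 2 := by positivity
  have hda0 : 0 < d * a := by positivity
  have hdiv : a / η ≤ b * x + c * y ^ 2 + d * a := by
    rcases min_choice (1 / d) (min x y) with h | h
    · have : a / η = d * a := by rw [hη, h]; field_simp
      linarith
    · rcases min_choice x y with h' | h'
      · have : a / η = b * x := by rw [hη, h, h', ← hbx]; field_simp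
        linarith
      · have : a / η = c * y ^ 2 := by rw [hη, h, h', ← hcy]; field_simp
        linarith
  linarith

theorem sqrt_mul_eq_mul_of_mul_sq_eq {a b x : ℝ} (hb : 0 ≤ b) (hx : 0 ≤ x)
    (h : b * x ^ 2 = a) : Real.sqrt (b * a) = b * x := by
  rw [← h, show b * (b * x ^ 2) = (b * x) ^ 2 by ring, Real.sqrt_sq (by positivity)]

theorem mul_sqrt_rpow_two_thirds {a c y : ℝ} (hc : 0 ≤ c) (hy : 0 ≤ y)
    (h : c * y ^ 3 = a) : (a * Real.sqrt c) ^ ((2 : ℝ) / 3) = c * y ^ 2 := by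
  have hs : a * Real.sqrt c = (Real.sqrt c * y) ^ (3 : ℝ) := by
    rw [← h, Real.rpow_ofNat]
    linear_combination -(y ^ 3 * Real.sqrt c) * Real.sq_sqrt hc
  rw [hs, ← Real.rpow_mul (by positivity), show (3 : ℝ) * (2 / 3) = 2 by norm_num,
    Real.rpow_two, mul_pow, Real.sq_sqrt hc]


/-- Explicit stepsize choice realizing the bound of the stepsize-tuning lemma (Lemma 5):
with `η = min { 1/d, √(r₀/(b(T+1))), (r₀/(c(T+1)))^{1/3} }`,
`r₀/((T+1)η) + bη + cη² ≤ 2√(b r₀/(T+1)) + 2 (r₀ √c/(T+1))^{2/3} + d r₀/(T+1)`. -/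
theorem stmt_1 (r : ℕ → ℝ) (hr : ∀ t, 0 ≤ r t) (hr0 : 0 < r 0)
    (d b c : ℝ) (hd : 0 < d) (hb : 0 < b) (hc : 0 < c) (T : ℕ)
    (η : ℝ)
    (hη : η = min (1 / d) (min (Real.sqrt (r 0 / (b * ((T : ℝ) + 1))))
      ((r 0 / (c * ((T : ℝ) + 1))) ^ ((1 : ℝ) / 3)))) :
    r 0 / (((T : ℝ) + 1) * η) + b * η + c * η ^ 2
      ≤ 2 * Real.sqrt (b * r 0 / ((T : ℝ) + 1))
        + 2 * (r 0 * Real.sqrt c / ((T : ℝ) + 1)) ^ ((2 : ℝ) / 3)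
        + d * r 0 / ((T : ℝ) + 1) := by
  have hT : (0 : ℝ) < (T : ℝ) + 1 := by positivity
  set a := r 0 / ((T : ℝ) + 1) with ha_def
  have ha : 0 < a := by positivity
  have hab : r 0 / (b * ((T : ℝ) + 1)) = a / b := by rw [ha_def]; field_simp
  have hac : r 0 / (c * ((T : ℝ) + 1)) = a / c := by rw [ha_def]; field_simp
  rw [hab, hac] at hη
  have hx : 0 < Real.sqrt (a / b) := by positivity
  have hy : 0 < (a / c) ^ ((1 : ℝ) / 3) := by positivity
  have hbx : b * Real.sqrt (a / b) ^ 2 = a := by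
    rw [Real.sq_sqrt (by positivity)]; field_simp
  have hcy : c * ((a / c) ^ ((1 : ℝ) / 3)) ^ 3 = a := by
    rw [← Real.rpow_mul_natCast (by positivity)]
    norm_num
    field_simp
  have key := div_min_add_le ha hb hc hd hx hy hbx hcy
  rw [← hη, ← sqrt_mul_eq_mul_of_mul_sq_eq hb.le hx.le hbx,
    ← mul_sqrt_rpow_two_thirds hc.le hy.le hcy] at key
  rwa [← div_div, mul_div_assoc b, mul_div_right_comm (r 0), mul_div_assoc d]
end

section
/- Let 0 < a < d, b > 0, c ≥ 0 be reals, let T ≥ 1 be a natural number, and let (r_t)_{t≥0} be a sequence of nonnegative reals. Set M := max{2, a²·r_0·T²/b} and η := min{1/d, (ln M)/(a·T)}, and define the weights ω_t := (1 − a·η)^{−(t+1)} for t ∈ ℕ and W_T := Σ_{t=0}^{T−1} ω_t. Then (1/(W_T·η)) · Σ_{t=0}^{T−1} ( ω_t·(1 − a·η)·r_t − ω_t·r_{t+1} ) + b·η + c·η² ≤ r_0·d·exp(−a·T/d) + (2 + ln M)·b/(a·T) + c·(ln M)²/(a²·T²). -/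
/-- The weighted differences telescope when the weights are the inverse powers of `q`. -/
theorem sum_inv_pow_telescope {q : ℝ} (hq : q ≠ 0) (r : ℕ → ℝ) (T : ℕ) :
    ∑ t ∈ Finset.range T, ((q ^ (t + 1))⁻¹ * q * r t - (q ^ (t + 1))⁻¹ * r (t + 1))
      = r 0 - (q ^ T)⁻¹ * r T := by
  induction T with
  | zero => simp
  | succ n ih =>
    have h : (q ^ (n + 1))⁻¹ * q = (q ^ n)⁻¹ := by
      rw [pow_succ, mul_inv, inv_mul_cancel_right₀ hq]
    rw [Finset.sum_range_succ, ih, h]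
    ring

/-- The sum of the inverse powers of `1 - x` grows at least exponentially. -/
theorem exp_le_sum_inv_pow {x : ℝ} (hx : x < 1) {T : ℕ} (hT : 1 ≤ T) :
    Real.exp (x * T) ≤ ∑ t ∈ Finset.range T, ((1 - x) ^ (t + 1))⁻¹ := by
  have hq : 0 < 1 - x := by linarith
  obtain ⟨n, rfl⟩ : ∃ n, T = n + 1 := ⟨T - 1, by omega⟩
  have hpow : (1 - x) ^ (n + 1) ≤ Real.exp (-(x * (n + 1 : ℕ))) := by
    calc (1 - x) ^ (n + 1) ≤ Real.exp (-x) ^ (n + 1) :=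
          pow_le_pow_left₀ hq.le (Real.one_sub_le_exp_neg x) _
      _ = Real.exp (-(x * (n + 1 : ℕ))) := by
          rw [← Real.exp_nat_mul]
          congr 1
          ring
  calc Real.exp (x * (n + 1 : ℕ)) = (Real.exp (-(x * (n + 1 : ℕ))))⁻¹ := by
        rw [Real.exp_neg, inv_inv]
    _ ≤ ((1 - x) ^ (n + 1))⁻¹ := inv_anti₀ (pow_pos hq _) hpow
    _ ≤ _ := Finset.single_le_sum (f := fun t => ((1 - x) ^ (t + 1))⁻¹)
        (fun t _ => (inv_pos.2 (pow_pos hq _)).le) (Finset.self_mem_range_succ n)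

/-- The weighted average of the differences is at most `r 0 / η` times a decaying exponential. -/
theorem weighted_telescope_le {a η : ℝ} (hη : 0 < η) (haη : a * η < 1) {T : ℕ} (hT : 1 ≤ T)
    {r : ℕ → ℝ} (hr : ∀ t, 0 ≤ r t) :
    (1 / ((∑ t ∈ Finset.range T, ((1 - a * η) ^ (t + 1))⁻¹) * η)) *
        (∑ t ∈ Finset.range T, (((1 - a * η) ^ (t + 1))⁻¹ * (1 - a * η) * r t
          - ((1 - a * η) ^ (t + 1))⁻¹ * r (t + 1)))
      ≤ r 0 / η * Real.exp (-(a * η * T)) := by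
  have hq : 0 < 1 - a * η := by linarith
  have hW := exp_le_sum_inv_pow haη hT
  have hE := Real.exp_pos (a * η * T)
  have hlast : 0 ≤ ((1 - a * η) ^ T)⁻¹ * r T := mul_nonneg (inv_pos.2 (pow_pos hq _)).le (hr T)
  rw [sum_inv_pow_telescope hq.ne']
  set W := ∑ t ∈ Finset.range T, ((1 - a * η) ^ (t + 1))⁻¹
  have hW0 : 0 < W := hE.trans_le hW
  have h0 := hr 0
  calc 1 / (W * η) * (r 0 - ((1 - a * η) ^ T)⁻¹ * r T)
      ≤ 1 / (W * η) * r 0 := by gcongr; linarith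
    _ ≤ 1 / (Real.exp (a * η * T) * η) * r 0 := by gcongr
    _ = r 0 / η * Real.exp (-(a * η * T)) := by
        rw [Real.exp_neg]
        field_simp


/-- Lemma 4 with the polylogarithmic factors made explicit: with
`M = max{2, a² r₀ T²/b}` and `η = min{1/d, ln M/(aT)}`, weights `ω t = (1 - aη)^{-(t+1)}`
and `W_T = ∑_{t<T} ω t`, the weighted telescoping sum plus `bη + cη²` is bounded by
`r₀ d e^{-aT/d} + (2 + ln M) b/(aT) + c (ln M)²/(a²T²)`. -/
theorem stmt_3 (a d b c : ℝ) (ha : 0 < a) (had : a < d) (hb : 0 < b) (hc : 0 ≤ c)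
    (T : ℕ) (hT : 1 ≤ T)
    (r : ℕ → ℝ) (hr : ∀ t, 0 ≤ r t)
    (M : ℝ) (hM : M = max 2 (a ^ 2 * r 0 * (T : ℝ) ^ 2 / b))
    (η : ℝ) (hη : η = min (1 / d) (Real.log M / (a * (T : ℝ))))
    (ω : ℕ → ℝ) (hω : ∀ t, ω t = ((1 - a * η) ^ (t + 1))⁻¹)
    (W : ℝ) (hW : W = ∑ t ∈ Finset.range T, ω t) :
    (1 / (W * η)) * (∑ t ∈ Finset.range T, (ω t * (1 - a * η) * r t - ω t * r (t + 1)))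
        + b * η + c * η ^ 2
      ≤ r 0 * d * Real.exp (-(a * (T : ℝ)) / d)
        + (2 + Real.log M) * b / (a * (T : ℝ))
        + c * (Real.log M) ^ 2 / (a ^ 2 * (T : ℝ) ^ 2) := by
  have hT0 : (0 : ℝ) < T := by exact_mod_cast hT
  have hd : 0 < d := ha.trans had
  have haT : 0 < a * T := mul_pos ha hT0
  have hM2 : 2 ≤ M := hM ▸ le_max_left _ _
  have hM0 : 0 < M := by linarith
  have hMr : a ^ 2 * r 0 * (T : ℝ) ^ 2 ≤ M * b :=
    (div_le_iff₀ hb).1 (hM ▸ le_max_right _ _)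
  have hlog : 1 / 2 ≤ Real.log M := by
    linarith [Real.log_le_log two_pos hM2, Real.log_two_gt_d9]
  have hlog0 : 0 < Real.log M := by linarith
  have hη0 : 0 < η := hη ▸ lt_min (by positivity) (by positivity)
  have hηd : η ≤ 1 / d := hη ▸ min_le_left _ _
  have hηlog : η ≤ Real.log M / (a * T) := hη ▸ min_le_right _ _
  have haη : a * η < 1 := by
    have h := (le_div_iff₀ hd).1 hηd
    nlinarith
  have h0 := hr 0
  have hmain := weighted_telescope_le hη0 haη hT hr
  simp only [← hω, ← hW] at hmain
  have hbη : b * η ≤ b * (Real.log M / (a * T)) := by gcongr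
  have hcη : c * η ^ 2 ≤ c * (Real.log M / (a * T)) ^ 2 := by gcongr
  have hb_eq : (2 + Real.log M) * b / (a * T)
      = 2 * b / (a * T) + b * (Real.log M / (a * T)) := by ring
  have hc_eq : c * (Real.log M) ^ 2 / (a ^ 2 * (T : ℝ) ^ 2)
      = c * (Real.log M / (a * T)) ^ 2 := by rw [div_pow, mul_pow, mul_div_assoc]
  have hexp : r 0 / η * Real.exp (-(a * η * T))
      ≤ r 0 * d * Real.exp (-(a * (T : ℝ)) / d) + 2 * b / (a * T) := by
    rcases min_choice (1 / d) (Real.log M / (a * T)) with h | h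
    · rw [← hη] at h
      have hpos : 0 ≤ 2 * b / (a * T) := by positivity
      have heq : r 0 / η * Real.exp (-(a * η * T))
          = r 0 * d * Real.exp (-(a * (T : ℝ)) / d) := by
        rw [h, div_div_eq_mul_div, div_one]
        congr 2
        ring
      linarith
    · rw [← hη] at h
      have hpos : 0 ≤ r 0 * d * Real.exp (-(a * (T : ℝ)) / d) := by positivity
      have hlogη : a * η * T = Real.log M := by
        rw [h]
        field_simp
      have hle : r 0 / η * Real.exp (-(a * η * T)) ≤ 2 * b / (a * T) := by
        rw [hlogη, Real.exp_neg, Real.exp_log hM0, h, ← div_eq_mul_inv, div_div,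
          div_le_div_iff₀ (by positivity) haT]
        have hrhs : 2 * b * (Real.log M / (a * T) * M) = 2 * Real.log M * (M * b) / (a * T) := by
          ring
        rw [hrhs, le_div_iff₀ haT]
        nlinarith [mul_pos hM0 hb]
      linarith
  rw [hb_eq, hc_eq]
  linarith
end

section
/- Assume L > 0 and μ ≥ 0, assume each f^v is L-smooth and μ-strongly convex, and let x* ∈ E be a global minimizer of f := Σ_{v=1}^V p_v f^v. Let x_1, …, x_V ∈ E, let x̄ := Σ_{v=1}^V p_v x_v be their weighted average, and let ḡ := Σ_{v=1}^V p_v ∇f^v(x_v). Then for every stepsize η with 0 < η ≤ 1/(4L): ‖x̄ − η·ḡ − x*‖² ≤ (1 − μ·η)·‖x̄ − x*‖² − η·( f(x̄) − f(x*) ) + 2·L·η · Σ_{v=1}^V p_v·‖x_v − x̄‖². -/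
open scoped RealInnerProductSpace

/-- Jensen's inequality for the squared norm. -/
theorem norm_sum_smul_sq_le {E ι : Type*} [NormedAddCommGroup E] [NormedSpace ℝ E] [Fintype ι]
    {p : ι → ℝ} (hp : ∀ v, 0 ≤ p v) (hpsum : ∑ v, p v = 1) (a : ι → E) :
    ‖∑ v, p v • a v‖ ^ 2 ≤ ∑ v, p v * ‖a v‖ ^ 2 := by
  have hconv : ConvexOn ℝ Set.univ fun z : E => ‖z‖ ^ 2 :=
    convexOn_univ_norm.pow (fun _ _ => norm_nonneg _) 2
  simpa using hconv.map_sum_le (fun v _ => hp v) hpsum (fun v _ => Set.mem_univ (a v))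

/-- The descent lemma: a function with Lipschitz gradient lies below its quadratic model. -/
theorem le_add_inner_add_of_lipschitz_gradient {E : Type*} [NormedAddCommGroup E]
    [InnerProductSpace ℝ E] [CompleteSpace E] {f : E → ℝ} {g : E → E}
    (hgrad : ∀ x, HasGradientAt f (g x) x) {L : ℝ} (hL : 0 ≤ L)
    (hg : LipschitzWith (Real.toNNReal L) g) (x y : E) :
    f y ≤ f x + ⟪g x, y - x⟫ + L / 2 * ‖y - x‖ ^ 2 := by
  let h : ℝ → ℝ := fun t =>
    f (x + t • (y - x)) - t * ⟪g x, y - x⟫ - t ^ 2 * (L / 2 * ‖y - x‖ ^ 2)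
  have hderiv : ∀ t, HasDerivAt h (⟪g (x + t • (y - x)), y - x⟫ - 1 * ⟪g x, y - x⟫
      - 2 * t * (L / 2 * ‖y - x‖ ^ 2)) t := by
    intro t
    have hline : HasDerivAt (fun t : ℝ => x + t • (y - x)) (y - x) t := by
      simpa using ((hasDerivAt_id t).smul_const (y - x)).const_add x
    have hf := (hgrad (x + t • (y - x))).hasFDerivAt.comp_hasDerivAt t hline
    have hf' : HasDerivAt (fun t : ℝ => f (x + t • (y - x)))
        ⟪g (x + t • (y - x)), y - x⟫ t := by
      simpa [Function.comp_def] using hf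
    have hsq : HasDerivAt (fun t : ℝ => t ^ 2) (2 * t) t := by
      simpa using hasDerivAt_pow 2 t
    exact (hf'.sub ((hasDerivAt_id t).mul_const _)).sub (hsq.mul_const _)
  have hanti : AntitoneOn h (Set.Ici 0) := by
    refine antitoneOn_of_deriv_nonpos (convex_Ici 0)
      (fun t _ => (hderiv t).continuousAt.continuousWithinAt)
      (fun t _ => (hderiv t).differentiableAt.differentiableWithinAt) fun t ht => ?_
    have ht0 : 0 ≤ t := interior_subset ht
    rw [(hderiv t).deriv]
    have hlip : ‖g (x + t • (y - x)) - g x‖ ≤ L * (t * ‖y - x‖) := by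
      simpa [hL, norm_smul, abs_of_nonneg ht0] using hg.norm_sub_le (x + t • (y - x)) x
    have hinner := real_inner_le_norm (g (x + t • (y - x)) - g x) (y - x)
    rw [inner_sub_left] at hinner
    nlinarith [mul_le_mul_of_nonneg_right hlip (norm_nonneg (y - x))]
  have := hanti (Set.mem_Ici.2 le_rfl) (Set.mem_Ici.2 zero_le_one) zero_le_one
  simp only [h, one_smul, zero_smul, add_sub_cancel, add_zero] at this
  linarith

/-- Deterministic core of Lemma 1 (inequality (eq31)): one step of weighted-average SGD
with exact gradients, under `L`-smoothness and `μ`-strong convexity of each local loss. -/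
theorem stmt_4 {E : Type*} [NormedAddCommGroup E] [InnerProductSpace ℝ E] [CompleteSpace E]
    (V : ℕ) (hV : 1 ≤ V)
    (p : Fin V → ℝ) (hp : ∀ v, 0 ≤ p v) (hpsum : ∑ v, p v = 1)
    (f : Fin V → E → ℝ) (G : Fin V → E → E)
    (hgrad : ∀ v x, HasGradientAt (f v) (G v x) x)
    (L μ : ℝ) (hL : 0 < L) (hμ : 0 ≤ μ)
    (hsmooth : ∀ v, LipschitzWith (Real.toNNReal L) (G v))
    (hsc : ∀ v x y, f v y ≥ f v x + ⟪G v x, y - x⟫ + μ / 2 * ‖y - x‖ ^ 2)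
    (F : E → ℝ) (hF : F = fun z => ∑ v, p v * f v z)
    (xstar : E) (hmin : ∀ y, F xstar ≤ F y)
    (x : Fin V → E) (xbar : E) (hxbar : xbar = ∑ v, p v • x v)
    (gbar : E) (hgbar : gbar = ∑ v, p v • G v (x v))
    (η : ℝ) (hη0 : 0 < η) (hη : η ≤ 1 / (4 * L)) :
    ‖xbar - η • gbar - xstar‖ ^ 2
      ≤ (1 - μ * η) * ‖xbar - xstar‖ ^ 2 - η * (F xbar - F xstar)
        + 2 * L * η * ∑ v, p v * ‖x v - xbar‖ ^ 2 := by
  have hdesc v := le_add_inner_add_of_lipschitz_gradient (hgrad v) hL.le (hsmooth v)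
  have hFs z : F z = ∑ v, p v * f v z := by rw [hF]
  set S := ∑ v, p v * ‖x v - xbar‖ ^ 2 with hS
  have hS0 : 0 ≤ S := Finset.sum_nonneg fun v _ => mul_nonneg (hp v) (sq_nonneg _)
  set d := ∑ v, p v • G v xbar with hd
  have hvar : ‖xbar - xstar‖ ^ 2 ≤ ∑ v, p v * ‖x v - xstar‖ ^ 2 := by
    have h := norm_sum_smul_sq_le hp hpsum fun v => x v - xstar
    simpa only [smul_sub, Finset.sum_sub_distrib, ← Finset.sum_smul, hpsum, one_smul,
      ← hxbar] using h
  have hgrad_diff : ‖gbar - d‖ ^ 2 ≤ L ^ 2 * S := by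
    have h := norm_sum_smul_sq_le hp hpsum fun v => G v (x v) - G v xbar
    simp only [smul_sub, Finset.sum_sub_distrib, ← hgbar, ← hd] at h
    refine h.trans ?_
    rw [hS, Finset.mul_sum]
    refine Finset.sum_le_sum fun v _ => ?_
    have hlip : ‖G v (x v) - G v xbar‖ ≤ L * ‖x v - xbar‖ := by
      simpa [hL.le] using (hsmooth v).norm_sub_le (x v) xbar
    calc p v * ‖G v (x v) - G v xbar‖ ^ 2 ≤ p v * (L * ‖x v - xbar‖) ^ 2 := by
          have := hp v
          gcongr
      _ = L ^ 2 * (p v * ‖x v - xbar‖ ^ 2) := by ring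
  have hgrad_norm : ‖d‖ ^ 2 ≤ 2 * L * (F xbar - F xstar) := by
    have hstep : F (xbar - L⁻¹ • d) ≤ F xbar - L⁻¹ / 2 * ‖d‖ ^ 2 := by
      have h : F (xbar - L⁻¹ • d) ≤ ∑ v, (p v * f v xbar - L⁻¹ * ⟪p v • G v xbar, d⟫
          + p v * (L⁻¹ / 2 * ‖d‖ ^ 2)) := by
        rw [hFs]
        refine Finset.sum_le_sum fun v _ => ?_
        have h := mul_le_mul_of_nonneg_left (hdesc v xbar (xbar - L⁻¹ • d)) (hp v)
        have hy : xbar - L⁻¹ • d - xbar = -(L⁻¹ • d) := by abel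
        rw [hy, inner_neg_right, norm_neg, real_inner_smul_right, norm_smul, mul_pow,
          Real.norm_eq_abs, sq_abs] at h
        rw [real_inner_smul_left]
        refine h.trans_eq ?_
        field_simp
        ring
      rw [Finset.sum_add_distrib, Finset.sum_sub_distrib, ← hFs, ← Finset.mul_sum,
        ← sum_inner, ← hd, ← Finset.sum_mul, hpsum, real_inner_self_eq_norm_sq] at h
      linarith
    have h : L⁻¹ / 2 * ‖d‖ ^ 2 ≤ F xbar - F xstar := by
      linarith [hmin (xbar - L⁻¹ • d)]
    calc ‖d‖ ^ 2 = 2 * L * (L⁻¹ / 2 * ‖d‖ ^ 2) := by field_simp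
      _ ≤ _ := by gcongr
  have hinner : -⟪gbar, xbar - xstar⟫ ≤ F xstar - F xbar + L / 2 * S
      - μ / 2 * ‖xbar - xstar‖ ^ 2 := by
    have h : ∑ v, -⟪p v • G v (x v), xbar - xstar⟫ ≤ ∑ v, (p v * f v xstar - p v * f v xbar
        + L / 2 * (p v * ‖x v - xbar‖ ^ 2) - μ / 2 * (p v * ‖x v - xstar‖ ^ 2)) := by
      refine Finset.sum_le_sum fun v _ => ?_
      have h₁ := hdesc v (x v) xbar
      have h₂ := hsc v (x v) xstar
      have h₃ : ⟪G v (x v), xbar - xstar⟫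
          = ⟪G v (x v), xbar - x v⟫ - ⟪G v (x v), xstar - x v⟫ := by
        rw [← inner_sub_right, sub_sub_sub_cancel_right]
      rw [norm_sub_rev] at h₁ h₂
      have h := mul_le_mul_of_nonneg_left (show -⟪G v (x v), xbar - xstar⟫ ≤ f v xstar
        - f v xbar + L / 2 * ‖x v - xbar‖ ^ 2 - μ / 2 * ‖x v - xstar‖ ^ 2 by linarith) (hp v)
      rw [real_inner_smul_left]
      linarith
    rw [Finset.sum_neg_distrib, ← sum_inner, ← hgbar, Finset.sum_sub_distrib,
      Finset.sum_add_distrib, Finset.sum_sub_distrib, ← hFs, ← hFs, ← Finset.mul_sum,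
      ← Finset.mul_sum, ← hS] at h
    linarith [mul_le_mul_of_nonneg_left hvar (div_nonneg hμ zero_le_two)]
  have hgbar_norm : ‖gbar‖ ^ 2 ≤ 2 * (L ^ 2 * S) + 2 * (2 * L * (F xbar - F xstar)) := by
    have h := parallelogram_law_with_norm ℝ (gbar - d) d
    rw [sub_add_cancel] at h
    nlinarith [mul_self_nonneg ‖gbar - d - d‖]
  have hexpand : ‖xbar - η • gbar - xstar‖ ^ 2
      = ‖xbar - xstar‖ ^ 2 - 2 * η * ⟪gbar, xbar - xstar⟫ + η ^ 2 * ‖gbar‖ ^ 2 := by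
    rw [sub_right_comm, norm_sub_sq_real, real_inner_smul_right, real_inner_comm, norm_smul,
      mul_pow, Real.norm_eq_abs, sq_abs]
    ring
  have hLη : 4 * L * η ≤ 1 := by
    rw [le_div_iff₀ (by positivity)] at hη
    linarith
  have hgap : 0 ≤ F xbar - F xstar := sub_nonneg.2 (hmin xbar)
  have hgap_step := mul_le_mul_of_nonneg_right hLη (mul_nonneg hη0.le hgap)
  have hS_step := mul_le_mul_of_nonneg_right hLη
    (mul_nonneg (mul_nonneg hL.le hη0.le) hS0)
  have hLηS : 0 ≤ L * η * S := by positivity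
  have hinner_step := mul_le_mul_of_nonneg_left hinner (mul_nonneg zero_le_two hη0.le)
  have hnorm_step := mul_le_mul_of_nonneg_left hgbar_norm (sq_nonneg η)
  rw [hexpand]
  linarith
end

section
/- Assume L > 0 and that each f^v is L-smooth, and let f := Σ_{v=1}^V p_v f^v. Let x_1, …, x_V ∈ E and x̄ ∈ E be arbitrary points, and let ḡ := Σ_{v=1}^V p_v ∇f^v(x_v). Then for every stepsize η with 0 < η ≤ 1/(4L): f( x̄ − η·ḡ ) ≤ f(x̄) − (η/4)·‖∇f(x̄)‖² + L²·η · Σ_{v=1}^V p_v·‖x_v − x̄‖². -/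
section

open Set

variable {E : Type*} [NormedAddCommGroup E] [InnerProductSpace ℝ E]

/-- **Descent lemma**: a function with `K`-Lipschitz gradient lies below its quadratic upper
model at every point. -/
theorem le_add_inner_add_of_lipschitzWith_gradient [CompleteSpace E] {f : E → ℝ} {g : E → E}
    {K : NNReal} (hf : ∀ x, HasGradientAt f (g x) x) (hg : LipschitzWith K g) (x d : E) :
    f (x + d) ≤ f x + inner ℝ (g x) d + K / 2 * ‖d‖ ^ 2 := by
  have hderiv (t : ℝ) :
      HasDerivAt (fun t : ℝ ↦ f (x + t • d) - t * inner ℝ (g x) d - K / 2 * ‖d‖ ^ 2 * t ^ 2)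
        (inner ℝ (g (x + t • d)) d - inner ℝ (g x) d - K * ‖d‖ ^ 2 * t) t := by
    have hline : HasDerivAt (fun t : ℝ ↦ x + t • d) d t := by
      simpa using ((hasDerivAt_id t).smul_const d).const_add x
    have hcomp : HasDerivAt (fun t : ℝ ↦ f (x + t • d)) (inner ℝ (g (x + t • d)) d) t := by
      simpa [Function.comp_def] using (hf (x + t • d)).hasFDerivAt.comp_hasDerivAt t hline
    have hlin := (hasDerivAt_id t).mul_const (inner ℝ (g x) d)
    have hquad := (hasDerivAt_pow 2 t).const_mul (K / 2 * ‖d‖ ^ 2 : ℝ)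
    refine ((hcomp.sub hlin).sub hquad).congr_deriv ?_
    push_cast
    ring
  have hanti := antitoneOn_of_deriv_nonpos (convex_Icc (0 : ℝ) 1)
    (fun t _ ↦ (hderiv t).continuousAt.continuousWithinAt)
    (fun t _ ↦ (hderiv t).differentiableAt.differentiableWithinAt) (fun t ht ↦ by
      rw [interior_Icc] at ht
      rw [(hderiv t).deriv, ← inner_sub_left]
      have hinner := real_inner_le_norm (g (x + t • d) - g x) d
      have hlip : ‖g (x + t • d) - g x‖ ≤ K * (t * ‖d‖) := by
        simpa [norm_smul, abs_of_pos ht.1] using hg.norm_sub_le (x + t • d) x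
      nlinarith [mul_le_mul_of_nonneg_right hlip (norm_nonneg d)])
  have hle := hanti (left_mem_Icc.2 zero_le_one) (right_mem_Icc.2 zero_le_one) zero_le_one
  simp only [one_smul, zero_smul, add_zero] at hle
  linarith

theorem sq_norm_sum_smul_le {ι : Type*} (s : Finset ι) {w : ι → ℝ} (u : ι → E)
    (hw : ∀ i ∈ s, 0 ≤ w i) (hsum : ∑ i ∈ s, w i = 1) :
    ‖∑ i ∈ s, w i • u i‖ ^ 2 ≤ ∑ i ∈ s, w i * ‖u i‖ ^ 2 := by
  simpa using ((convexOn_norm (convex_univ (𝕜 := ℝ) (E := E))).pow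
    (fun _ _ ↦ norm_nonneg _) 2).map_sum_le hw hsum (fun i _ ↦ mem_univ (u i))

end


/-- Deterministic core of Lemma 2: one step of descent along the weighted-average gradient
direction, under `L`-smoothness of each local loss, without convexity. -/
theorem stmt_6 {E : Type*} [NormedAddCommGroup E] [InnerProductSpace ℝ E] [CompleteSpace E]
    (V : ℕ) (hV : 1 ≤ V)
    (p : Fin V → ℝ) (hp : ∀ v, 0 ≤ p v) (hpsum : ∑ v, p v = 1)
    (f : Fin V → E → ℝ) (G : Fin V → E → E)
    (hgrad : ∀ v x, HasGradientAt (f v) (G v x) x)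
    (L : ℝ) (hL : 0 < L)
    (hsmooth : ∀ v, LipschitzWith (Real.toNNReal L) (G v))
    (F : E → ℝ) (hF : F = fun z => ∑ v, p v * f v z)
    (Fgrad : E → E) (hFgrad : Fgrad = fun z => ∑ v, p v • G v z)
    (x : Fin V → E) (xbar : E)
    (gbar : E) (hgbar : gbar = ∑ v, p v • G v (x v))
    (η : ℝ) (hη0 : 0 < η) (hη : η ≤ 1 / (4 * L)) :
    F (xbar - η • gbar)
      ≤ F xbar - (η / 4) * ‖Fgrad xbar‖ ^ 2
        + L ^ 2 * η * ∑ v, p v * ‖x v - xbar‖ ^ 2 := by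
  have hdesc : F (xbar - η • gbar)
      ≤ F xbar - η * inner ℝ (Fgrad xbar) gbar + L / 2 * (η ^ 2 * ‖gbar‖ ^ 2) := by
    have hmodel (v : Fin V) : f v (xbar - η • gbar)
        ≤ f v xbar - η * inner ℝ (G v xbar) gbar + L / 2 * (η ^ 2 * ‖gbar‖ ^ 2) := by
      have h := le_add_inner_add_of_lipschitzWith_gradient (hgrad v) (hsmooth v) xbar
        (-(η • gbar))
      rw [← sub_eq_add_neg, inner_neg_right, real_inner_smul_right, norm_neg, norm_smul, mul_pow,
        Real.norm_eq_abs, sq_abs, Real.coe_toNNReal L hL.le] at h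
      linarith
    calc F (xbar - η • gbar) = ∑ v, p v * f v (xbar - η • gbar) := by rw [hF]
      _ ≤ ∑ v, p v * (f v xbar - η * inner ℝ (G v xbar) gbar
            + L / 2 * (η ^ 2 * ‖gbar‖ ^ 2)) :=
        Finset.sum_le_sum fun v _ ↦ mul_le_mul_of_nonneg_left (hmodel v) (hp v)
      _ = F xbar - η * inner ℝ (Fgrad xbar) gbar + L / 2 * (η ^ 2 * ‖gbar‖ ^ 2) := by
        simp only [hF, hFgrad, sum_inner, real_inner_smul_left, mul_add, mul_sub,
          Finset.sum_add_distrib, Finset.sum_sub_distrib, ← Finset.sum_mul, hpsum, one_mul,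
          Finset.mul_sum, mul_left_comm η]
  have herr : ‖gbar - Fgrad xbar‖ ^ 2 ≤ L ^ 2 * ∑ v, p v * ‖x v - xbar‖ ^ 2 := by
    have hsub : gbar - Fgrad xbar = ∑ v, p v • (G v (x v) - G v xbar) := by
      simp only [hgbar, hFgrad, smul_sub, Finset.sum_sub_distrib]
    rw [hsub, Finset.mul_sum]
    refine (sq_norm_sum_smul_le _ _ (fun v _ ↦ hp v) hpsum).trans
      (Finset.sum_le_sum fun v _ ↦ ?_)
    have hlip := (hsmooth v).norm_sub_le (x v) xbar
    rw [Real.coe_toNNReal L hL.le] at hlip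
    calc p v * ‖G v (x v) - G v xbar‖ ^ 2 ≤ p v * (L * ‖x v - xbar‖) ^ 2 := by
          have := hp v
          gcongr
      _ = L ^ 2 * (p v * ‖x v - xbar‖ ^ 2) := by ring
  have hstep : η * L ≤ 1 / 4 := by
    rw [le_div_iff₀ (by positivity)] at hη
    linarith
  have hpolar := norm_sub_sq_real gbar (Fgrad xbar)
  rw [real_inner_comm] at hpolar
  have herr' := mul_le_mul_of_nonneg_left herr hη0.le
  have hgsq : 0 ≤ η * ‖gbar‖ ^ 2 * (1 / 4 - η * L) :=
    mul_nonneg (by positivity) (by linarith)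
  have hpolar' : η * ‖gbar - Fgrad xbar‖ ^ 2 = η * ‖gbar‖ ^ 2
      - 2 * (η * inner ℝ (Fgrad xbar) gbar) + η * ‖Fgrad xbar‖ ^ 2 := by
    rw [hpolar]; ring
  have hA : 0 ≤ η * ‖Fgrad xbar‖ ^ 2 := by positivity
  have hB : 0 ≤ η * ‖gbar‖ ^ 2 := by positivity
  have hC : 0 ≤ η * ‖gbar - Fgrad xbar‖ ^ 2 := by positivity
  linarith
end

section
/- Let η > 0, a ≥ 0 with a·η < 1, b ≥ 0, and T ≥ 1 a natural number. Let (r_t)_{0≤t≤T} be nonnegative reals and (s_t)_{0≤t<T} reals satisfying r_{t+1} ≤ (1 − a·η)·r_t − η·s_t + b·η² for all 0 ≤ t < T. Define ω_t := (1 − a·η)^{−(t+1)} and W_T := Σ_{t=0}^{T−1} ω_t. Then (1/W_T) · Σ_{t=0}^{T−1} ω_t·s_t ≤ (r_0/η)·exp(−a·η·T) + b·η. -/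
/-- Telescoped form of the recursion `r (t+1) ≤ q r t - η s t + c` with weights `q^{-(t+1)}`. -/
theorem weighted_sum_add_le_of_recursion {q η c : ℝ} (hq : 0 < q) {r s : ℕ → ℝ} {n : ℕ}
    (hrec : ∀ t < n, r (t + 1) ≤ q * r t - η * s t + c) :
    η * ∑ t ∈ Finset.range n, (q ^ (t + 1))⁻¹ * s t + (q ^ n)⁻¹ * r n
      ≤ r 0 + c * ∑ t ∈ Finset.range n, (q ^ (t + 1))⁻¹ := by
  induction n with
  | zero => simp
  | succ n ih =>
    have ih := ih fun t ht => hrec t (ht.trans n.lt_succ_self)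
    have hstep := mul_le_mul_of_nonneg_left (hrec n n.lt_succ_self)
      (inv_nonneg.2 (pow_pos hq (n + 1)).le)
    have hω : (q ^ (n + 1))⁻¹ * q = (q ^ n)⁻¹ := by
      rw [pow_succ]
      field_simp
    rw [Finset.sum_range_succ, Finset.sum_range_succ]
    linear_combination ih + hstep + r n * hω

/-- `(1 - x)^n ≤ e^{-nx}` for `x ≤ 1`. -/
theorem one_sub_pow_le_exp_neg_mul {x : ℝ} (hx : x ≤ 1) (n : ℕ) :
    (1 - x) ^ n ≤ Real.exp (-(x * n)) := by
  calc (1 - x) ^ n ≤ Real.exp (-x) ^ n :=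
        pow_le_pow_left₀ (sub_nonneg.2 hx) (Real.one_sub_le_exp_neg x) n
    _ = Real.exp (-(x * n)) := by rw [← Real.exp_nat_mul]; ring_nf

/-- Weighted-recursion-to-rate conversion underlying the strongly convex case of Theorem 1:
if `r (t+1) ≤ (1 - aη) r t - η s t + b η²`, then with weights `ω t = (1 - aη)^{-(t+1)}` and
`W = ∑_{t<T} ω t`, `(1/W) ∑_{t<T} ω t * s t ≤ (r 0/η) e^{-aηT} + bη`. -/
theorem stmt_13 (η a b : ℝ) (hη : 0 < η) (ha : 0 ≤ a) (haη : a * η < 1) (hb : 0 ≤ b)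
    (T : ℕ) (hT : 1 ≤ T)
    (r : ℕ → ℝ) (hr : ∀ t ≤ T, 0 ≤ r t)
    (s : ℕ → ℝ)
    (hrec : ∀ t < T, r (t + 1) ≤ (1 - a * η) * r t - η * s t + b * η ^ 2)
    (ω : ℕ → ℝ) (hω : ∀ t, ω t = ((1 - a * η) ^ (t + 1))⁻¹)
    (W : ℝ) (hW : W = ∑ t ∈ Finset.range T, ω t) :
    (1 / W) * ∑ t ∈ Finset.range T, ω t * s t
      ≤ (r 0 / η) * Real.exp (-(a * η * (T : ℝ))) + b * η := by
  have hq : 0 < 1 - a * η := sub_pos.2 haη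
  have hωpos : ∀ t, 0 < ω t := fun t => hω t ▸ inv_pos.2 (pow_pos hq _)
  have hmain := weighted_sum_add_le_of_recursion hq hrec
  simp only [← hω, ← hW] at hmain
  have hWge : ((1 - a * η) ^ T)⁻¹ ≤ W := by
    have hlast := Finset.single_le_sum (fun t _ => (hωpos t).le)
      (Finset.mem_range.2 (Nat.sub_lt hT one_pos))
    rwa [hω, Nat.sub_add_cancel hT, ← hW] at hlast
  have hWpos : 0 < W := (inv_pos.2 (pow_pos hq T)).trans_le hWge
  have hinv : W⁻¹ ≤ Real.exp (-(a * η * T)) :=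
    (inv_le_of_inv_le₀ (pow_pos hq T) hWge).trans (one_sub_pow_le_exp_neg_mul haη.le T)
  have hrT : 0 ≤ ((1 - a * η) ^ T)⁻¹ * r T :=
    mul_nonneg (inv_pos.2 (pow_pos hq T)).le (hr T le_rfl)
  calc (1 / W) * ∑ t ∈ Finset.range T, ω t * s t
      = (η * ∑ t ∈ Finset.range T, ω t * s t) / (η * W) := by field_simp
    _ ≤ (r 0 + b * η ^ 2 * W) / (η * W) := by
        gcongr
        linarith
    _ = (r 0 / η) * W⁻¹ + b * η := by field_simp
    _ ≤ (r 0 / η) * Real.exp (-(a * η * T)) + b * η := by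
        have := div_nonneg (hr 0 T.zero_le) hη.le
        gcongr
end
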